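/- Let m ∈ L¹(Ω) with 0 ≤ m and m ≢ 0. Assume hypothesis H1′ on φ with exponent p and hypothesis F1′ on f with exponents q₁ ∈ (0,p) and q₂ ∈ (0,1). Then for every λ > 0 there exists a solution u = u_λ ∈ C¹([a,b]) of the problem −(φ(u′))′ = λ m(x) f(u) in Ω, u = 0 on ∂Ω, with u > 0 on (a,b) and u′(b) < 0 < u′(a). -/

import Mathlib

open MeasureTheory Set Filter

/-- `u` is a solution of `-(φ(u'))' = h` in `Ω = (a,b)`, `u = 0` on `∂Ω`. -/
def IsSol (a b : ℝ) (φ h u u' : ℝ → ℝ) : Prop :=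
  u a = 0 ∧ u b = 0 ∧
  ContinuousOn u' (Set.Icc a b) ∧
  (∀ x ∈ Set.Icc a b, HasDerivWithinAt u (u' x) (Set.Icc a b) x) ∧
  (∀ x ∈ Set.Icc a b, φ (u' x) = φ (u' a) - ∫ t in a..x, h t)

lemma aux_int_bounds (μ : Measure ℝ) [IsFiniteMeasure μ] {a b K : ℝ} {g : ℝ → ℝ}
    (hg : Continuous g) (h0 : ∀ t, 0 ≤ g t) (hK : ∀ t, g t ≤ K) {y : ℝ} (hy : y ∈ Icc a b) :
    0 ≤ ∫ t in a..y, g t ∂μ ∧ ∫ t in a..y, g t ∂μ ≤ K * μ.real (Ioc a b) := by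
  have hK0 : 0 ≤ K := (h0 0).trans (hK 0)
  refine ⟨intervalIntegral.integral_nonneg hy.1 fun t _ => h0 t, ?_⟩
  calc ∫ t in a..y, g t ∂μ ≤ ∫ t in a..y, K ∂μ :=
        intervalIntegral.integral_mono_on hy.1 (hg.intervalIntegrable _ _)
          (continuous_const.intervalIntegrable _ _) fun t _ => hK t
    _ = K * μ.real (Ioc a y) := by
        rw [intervalIntegral.integral_of_le hy.1, setIntegral_const, smul_eq_mul, mul_comm]
    _ ≤ _ := by
        gcongr
        · simp
        · exact hy.2

lemma aux_int_nonpos {a b : ℝ} (hab : a ≤ b) {g : ℝ → ℝ} (h : ∀ t ∈ Icc a b, g t ≤ 0) :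
    ∫ t in a..b, g t ≤ 0 := by
  have := intervalIntegral.integral_nonneg (μ := volume) (f := fun t => - g t) hab
    fun t ht => neg_nonneg.2 (h t ht)
  rw [intervalIntegral.integral_neg] at this
  linarith

/-- Delayed iteration for the shooting method. -/
noncomputable def delayIter (a δ : ℝ) (μ : Measure ℝ) (F : ℝ → ℝ → ℝ) (ψ : ℝ → ℝ) :
    ℕ → ℝ → ℝ → ℝ
  | 0 => fun _ _ => 0
  | k + 1 => fun s x => ∫ y in a..x, ψ (s - ∫ t in a..y,
      F t (delayIter a δ μ F ψ k s (max (t - δ) a)) ∂μ)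

lemma delayIter_cont (a δ : ℝ) (μ : Measure ℝ) [IsFiniteMeasure μ] [NullSingletonClass μ]
    (F : ℝ → ℝ → ℝ) (hF : Continuous (Function.uncurry F)) (ψ : ℝ → ℝ) (hψ : Continuous ψ)
    (k : ℕ) : Continuous (Function.uncurry (delayIter a δ μ F ψ k)) := by
  induction k with
  | zero => exact continuous_const
  | succ k ih =>
    have h1 : Continuous (fun q : ℝ × ℝ => ∫ t in a..q.2,
        F t (delayIter a δ μ F ψ k q.1 (max (t - δ) a)) ∂μ) := by
      apply intervalIntegral.continuous_parametric_intervalIntegral_of_continuous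
        (f := fun (q : ℝ × ℝ) t => F t (delayIter a δ μ F ψ k q.1 (max (t - δ) a)))
      · have h2 : Continuous fun z : (ℝ × ℝ) × ℝ =>
            delayIter a δ μ F ψ k z.1.1 (max (z.2 - δ) a) :=
          ih.comp (f := fun z : (ℝ × ℝ) × ℝ => (z.1.1, max (z.2 - δ) a)) (by fun_prop)
        exact hF.comp (continuous_snd.prodMk h2)
      · exact continuous_snd
    apply intervalIntegral.continuous_parametric_intervalIntegral_of_continuous
        (f := fun (q : ℝ × ℝ) y => ψ (q.1 - ∫ t in a..y,
          F t (delayIter a δ μ F ψ k q.1 (max (t - δ) a)) ∂μ))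
    · apply hψ.comp
      have := h1.comp (f := fun z : (ℝ × ℝ) × ℝ => (z.1.1, z.2)) (by fun_prop)
      exact (by fun_prop : Continuous fun z : (ℝ × ℝ) × ℝ => z.1.1).sub this
    · exact continuous_snd

lemma delayIter_stab (a δ : ℝ) (hδ : 0 ≤ δ) (μ : Measure ℝ)
    (F : ℝ → ℝ → ℝ) (ψ : ℝ → ℝ) (s : ℝ)
    (k : ℕ) : ∀ x ∈ Icc a (a + k * δ),
      delayIter a δ μ F ψ k s x = delayIter a δ μ F ψ (k+1) s x := by
  induction k with
  | zero =>
    intro x hx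
    have : x = a := by simpa using hx
    subst this
    simp [delayIter]
  | succ k ih =>
    intro x hx
    rw [delayIter, delayIter]
    apply intervalIntegral.integral_congr
    intro y hy
    rw [uIcc_of_le hx.1] at hy
    dsimp only
    congr 2
    apply intervalIntegral.integral_congr
    intro t ht
    rw [uIcc_of_le hy.1] at ht
    dsimp only
    rw [ih]
    refine ⟨le_max_right _ _, max_le ?_ ?_⟩
    · have := ht.2.trans (hy.2.trans hx.2)
      push_cast at this
      linarith
    · nlinarith [show (0:ℝ) ≤ k * δ by positivity]

lemma approx_sol (a b : ℝ) (hab : a < b) (μ : Measure ℝ) [IsFiniteMeasure μ] [NullSingletonClass μ]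
    (F : ℝ → ℝ → ℝ) (hF : Continuous (Function.uncurry F)) (K : ℝ) (h0 : ∀ t u, 0 ≤ F t u)
    (hK : ∀ t u, F t u ≤ K) (ψ : ℝ → ℝ) (hψ : Continuous ψ) (hm : Monotone ψ) (hψ0 : ψ 0 = 0)
    (n : ℕ) :
    ∃ s ∈ Icc 0 (K * μ.real (Ioc a b)), ∃ u : ℝ → ℝ, Continuous u ∧
      (∀ x ∈ Icc a b, u x = ∫ y in a..x, ψ (s - ∫ t in a..y,
        F t (u (max (t - (b - a) / (n + 1)) a)) ∂μ)) ∧ u b = 0 := by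
  set δ := (b - a) / (n + 1) with hδ
  have hδ0 : 0 ≤ δ := by rw [hδ]; have := sub_pos.2 hab; positivity
  have hend : a + ((n + 1 : ℕ) : ℝ) * δ = b := by
    rw [hδ]; push_cast; field_simp; ring
  set U := delayIter a δ μ F ψ (n + 1) with hU
  have hUc : Continuous (Function.uncurry U) := delayIter_cont a δ μ F hF ψ hψ _
  have hfix : ∀ s, ∀ x ∈ Icc a b, U s x = ∫ y in a..x, ψ (s - ∫ t in a..y,
        F t (U s (max (t - δ) a)) ∂μ) := by
    intro s x hx
    rw [hU, delayIter_stab a δ hδ0 μ F ψ s (n+1) x (by rwa [hend]), delayIter]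
  have hUs : ∀ s, Continuous (U s) := fun s => hUc.comp (by fun_prop : Continuous fun x => (s, x))
  have hgc : ∀ s, Continuous fun t => F t (U s (max (t - δ) a)) := fun s =>
    hF.comp (continuous_id.prodMk ((hUs s).comp (by fun_prop)))
  have hb : Continuous fun s => U s b := hUc.comp (by fun_prop : Continuous fun s => (s, b))
  have hS0 : 0 ≤ K * μ.real (Ioc a b) :=
    mul_nonneg ((h0 0 0).trans (hK 0 0)) measureReal_nonneg
  have hlo : U 0 b ≤ 0 := by
    rw [hfix 0 b ⟨hab.le, le_rfl⟩]
    apply aux_int_nonpos hab.le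
    intro y hy
    refine le_of_le_of_eq (hm ?_) hψ0
    have := (aux_int_bounds μ (hgc 0) (fun t => h0 _ _) (fun t => hK _ _) hy).1
    linarith
  have hhi : 0 ≤ U (K * μ.real (Ioc a b)) b := by
    rw [hfix _ b ⟨hab.le, le_rfl⟩]
    apply intervalIntegral.integral_nonneg hab.le
    intro y hy
    rw [← hψ0]
    apply hm
    have := (aux_int_bounds μ (hgc (K * μ.real (Ioc a b))) (fun t => h0 _ _) (fun t => hK _ _) hy).2
    linarith
  obtain ⟨s, hs, hs0⟩ := intermediate_value_Icc hS0 hb.continuousOn ⟨hlo, hhi⟩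
  exact ⟨s, hs, U s, hUs s, hfix s, hs0⟩

lemma ascoli_aux (a b L : ℝ) (hab : a ≤ b) (hL : 0 ≤ L) (u : ℕ → ℝ → ℝ)
    (h0 : ∀ n, u n a = 0)
    (hlip : ∀ n, ∀ x ∈ Icc a b, ∀ y ∈ Icc a b, |u n x - u n y| ≤ L * |x - y|) :
    ∃ w : ℝ → ℝ, Continuous w ∧ ∃ g : ℕ → ℕ, StrictMono g ∧
      ∀ x ∈ Icc a b, Tendsto (fun k => u (g k) x) atTop (nhds (w x)) := by
  have hlw : ∀ n, LipschitzWith (Real.toNNReal L) (fun x : Icc a b => u n x) := by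
    intro n
    apply LipschitzWith.of_dist_le_mul
    intro x y
    rw [Real.dist_eq, Subtype.dist_eq, Real.dist_eq, Real.coe_toNNReal L hL]
    exact hlip n x x.2 y y.2
  let U : ℕ → BoundedContinuousFunction (Icc a b) ℝ := fun n =>
    BoundedContinuousFunction.mkOfCompact ⟨fun x => u n x, (hlw n).continuous⟩
  have hUe : ∀ n x, U n x = u n x := fun n x => rfl
  have hc : IsCompact (closure (range U)) := by
    apply BoundedContinuousFunction.arzela_ascoli (Metric.closedBall 0 (L * (b - a)))
      (isCompact_closedBall _ _)
    · rintro _ x ⟨n, rfl⟩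
      rw [hUe, mem_closedBall_zero_iff, Real.norm_eq_abs]
      have := hlip n x x.2 a ⟨le_rfl, hab⟩
      rw [h0, sub_zero, abs_of_nonneg (sub_nonneg.2 x.2.1)] at this
      refine this.trans ?_
      have := x.2.2
      gcongr
    · apply LipschitzWith.uniformEquicontinuous _ (Real.toNNReal L) _ |>.equicontinuous
      rintro ⟨_, n, rfl⟩
      exact hlw n
  obtain ⟨w, -, g, hg, hlim⟩ := hc.tendsto_subseq (x := U) fun n => subset_closure ⟨n, rfl⟩
  refine ⟨fun x => w (projIcc a b hab x), w.continuous.comp continuous_projIcc, g, hg, ?_⟩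
  intro x hx
  beta_reduce
  rw [projIcc_of_mem hab hx]
  have hev : Continuous fun v : BoundedContinuousFunction (Icc a b) ℝ => v ⟨x, hx⟩ := by fun_prop
  have := (hev.tendsto w).comp hlim
  exact this

lemma exists_sol (a b : ℝ) (hab : a < b) (μ : Measure ℝ) [IsFiniteMeasure μ]
    [NullSingletonClass μ]
    (F : ℝ → ℝ → ℝ) (hF : Continuous (Function.uncurry F)) (K : ℝ) (h0 : ∀ t u, 0 ≤ F t u)
    (hK : ∀ t u, F t u ≤ K) (ψ : ℝ → ℝ) (hψ : Continuous ψ) (hm : Monotone ψ) 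
    (hodd : ∀ x, ψ (-x) = - ψ x) :
    ∃ s ∈ Icc 0 (K * μ.real (Ioc a b)), ∃ u : ℝ → ℝ, Continuous u ∧
      (∀ x ∈ Icc a b, u x = ∫ y in a..x, ψ (s - ∫ t in a..y, F t (u t) ∂μ)) ∧ u b = 0 := by
  have hψ0 : ψ 0 = 0 := by have := hodd 0; rw [neg_zero] at this; linarith
  choose s hs u huc hu hub using approx_sol a b hab μ F hF K h0 hK ψ hψ hm hψ0
  set S := K * μ.real (Ioc a b) with hS
  have hS0 : 0 ≤ S :=
    mul_nonneg ((h0 0 0).trans (hK 0 0)) measureReal_nonneg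
  have hL : 0 ≤ ψ S := by rw [← hψ0]; exact hm hS0
  have hgc : ∀ n : ℕ, Continuous fun t => F t (u n (max (t - (b - a) / (n + 1)) a)) := fun n =>
    hF.comp (continuous_id.prodMk ((huc n).comp (by fun_prop)))
  have hvc : ∀ n : ℕ, Continuous fun y => ψ (s n - ∫ t in a..y,
        F t (u n (max (t - (b - a) / (n + 1)) a)) ∂μ) := fun n => by
    apply hψ.comp
    apply continuous_const.sub
    apply intervalIntegral.continuous_parametric_intervalIntegral_of_continuous
      (f := fun (q : ℝ) t => F t (u n (max (t - (b - a) / (n + 1)) a)))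
    · exact (hgc n).comp continuous_snd
    · exact continuous_id
  have hvb : ∀ n : ℕ, ∀ y ∈ Icc a b, |ψ (s n - ∫ t in a..y,
        F t (u n (max (t - (b - a) / (n + 1)) a)) ∂μ)| ≤ ψ S := by
    intro n y hy
    have := aux_int_bounds μ (hgc n) (fun t => h0 _ _) (fun t => hK _ _) hy
    have h2 := hs n
    rw [abs_le, ← hodd]
    constructor <;> apply hm <;> linarith [h2.1, h2.2]
  have hlip : ∀ n, ∀ x ∈ Icc a b, ∀ y ∈ Icc a b, |u n x - u n y| ≤ ψ S * |x - y| := by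
    intro n x hx y hy
    rw [hu n x hx, hu n y hy, intervalIntegral.integral_interval_sub_left
      ((hvc n).intervalIntegrable _ _) ((hvc n).intervalIntegrable _ _), ← Real.norm_eq_abs]
    apply intervalIntegral.norm_integral_le_of_norm_le_const
    intro z hz
    have hz' := uIoc_subset_uIcc hz
    exact hvb n z (uIcc_subset_Icc hy hx hz')
  have hua : ∀ n, u n a = 0 := fun n => by rw [hu n a ⟨le_rfl, hab.le⟩]; simp
  obtain ⟨w, hw, g, hg, hlim⟩ := ascoli_aux a b (ψ S) hab.le hL u hua hlip
  obtain ⟨s₀, hs₀, g', hg', hlim'⟩ := isCompact_Icc.tendsto_subseq (x := fun k => s (g k))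
    fun k => hs (g k)
  set G := g ∘ g' with hG
  have hGm : StrictMono G := hg.comp hg'
  have hlimG : ∀ x ∈ Icc a b, Tendsto (fun k => u (G k) x) atTop (nhds (w x)) :=
    fun x hx => (hlim x hx).comp hg'.tendsto_atTop
  have hδ : Tendsto (fun k => (b - a) / ((G k : ℝ) + 1)) atTop (nhds 0) := by
    have h1 : Tendsto (fun n : ℕ => (b - a) / ((n : ℝ) + 1)) atTop (nhds 0) := by
      have := (tendsto_one_div_add_atTop_nhds_zero_nat (𝕜 := ℝ)).const_mul (b - a)
      simpa [div_eq_mul_inv] using this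
    exact h1.comp hGm.tendsto_atTop
  have hdel : ∀ t ∈ Icc a b, Tendsto (fun k => u (G k) (max (t - (b - a) / ((G k : ℝ) + 1)) a))
      atTop (nhds (w t)) := by
    intro t ht
    have hz : Tendsto (fun k => u (G k) (max (t - (b - a) / ((G k : ℝ) + 1)) a) - u (G k) t)
        atTop (nhds 0) := by
      apply squeeze_zero_norm (a := fun k => ψ S * ((b - a) / ((G k : ℝ) + 1)))
      · intro k
        have hd : 0 ≤ (b - a) / ((G k : ℝ) + 1) := by have := sub_pos.2 hab; positivity
        refine (hlip _ _ ⟨le_max_right _ _, max_le ?_ hab.le⟩ t ht).trans ?_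
        · linarith [ht.2]
        · gcongr
          rw [abs_le]
          constructor
          · have := le_max_left (t - (b - a) / ((G k : ℝ) + 1)) a
            linarith
          · have : max (t - (b - a) / ((G k : ℝ) + 1)) a ≤ t := max_le (by linarith) ht.1
            linarith
      · simpa using hδ.const_mul (ψ S)
    simpa using hz.add (hlimG t ht)
  have hv : ∀ y ∈ Icc a b, Tendsto (fun k => ∫ t in a..y,
        F t (u (G k) (max (t - (b - a) / ((G k : ℝ) + 1)) a)) ∂μ) atTop
        (nhds (∫ t in a..y, F t (w t) ∂μ)) := by
    intro y hy
    apply intervalIntegral.tendsto_integral_filter_of_dominated_convergence (fun _ => K)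
    · exact Eventually.of_forall fun k => (hgc (G k)).aestronglyMeasurable
    · refine Eventually.of_forall fun k => Eventually.of_forall fun t _ => ?_
      rw [Real.norm_eq_abs, abs_of_nonneg (h0 _ _)]
      exact hK _ _
    · exact continuous_const.intervalIntegrable _ _
    · refine Eventually.of_forall fun t ht => ?_
      rw [uIoc_of_le hy.1] at ht
      have hFt : Continuous (F t) := hF.comp (by fun_prop : Continuous fun x => (t, x))
      exact (hFt.tendsto _).comp (hdel t ⟨ht.1.le, ht.2.trans hy.2⟩)
  refine ⟨s₀, hs₀, w, hw, ?_, ?_⟩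
  · intro x hx
    refine tendsto_nhds_unique (hlimG x hx) ?_
    simp_rw [hu _ x hx]
    apply intervalIntegral.tendsto_integral_filter_of_dominated_convergence (fun _ => ψ S)
    · exact Eventually.of_forall fun k => (hvc (G k)).aestronglyMeasurable
    · refine Eventually.of_forall fun k => Eventually.of_forall fun t ht => ?_
      rw [uIoc_of_le hx.1] at ht
      exact hvb _ _ ⟨ht.1.le, ht.2.trans hx.2⟩
    · exact continuous_const.intervalIntegrable _ _
    · refine Eventually.of_forall fun t ht => ?_
      rw [uIoc_of_le hx.1] at ht
      exact (hψ.tendsto _).comp (hlim'.sub (hv t ⟨ht.1.le, ht.2.trans hx.2⟩))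
  · refine tendsto_nhds_unique (hlimG b ⟨hab.le, le_rfl⟩) ?_
    simp [hub]

lemma exists_R (φ : ℝ → ℝ) (hmono : StrictMono φ) (hsurj : Function.Surjective φ)
    (h0 : φ 0 = 0) (c : ℝ) (hc : 0 < c) (A q : ℝ) (hA : 0 ≤ A) (hq : 0 < q) (hq1 : q < 1)
    (hH : ∃ C : ℝ, ∀ᶠ t in atTop, φ (c * t) / φ t ≤ C) :
    ∃ t > 0, A * φ (c * t) ^ q ≤ φ t := by
  obtain ⟨C, hC⟩ := hH
  have ht : Tendsto φ atTop atTop := hmono.monotone.tendsto_atTop_atTop fun b => by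
    obtain ⟨x, hx⟩ := hsurj b
    exact ⟨x, hx.ge⟩
  have h2 : Tendsto (fun t => φ t ^ (1 - q)) atTop atTop :=
    (tendsto_rpow_atTop (by linarith)).comp ht
  obtain ⟨t, hCt, h1, ht0⟩ := (hC.and ((h2.eventually_ge_atTop (A * (max C 1) ^ q)).and
    (eventually_gt_atTop 0))).exists
  refine ⟨t, ht0, ?_⟩
  have hp : 0 < φ t := by rw [← h0]; exact hmono ht0
  have hp' : 0 < φ (c * t) := by rw [← h0]; exact hmono (by positivity)
  rw [div_le_iff₀ hp] at hCt
  have hCC : φ (c * t) ≤ max C 1 * φ t := hCt.trans (by gcongr; exact le_max_left _ _)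
  have hC0 : 0 < max C 1 := lt_of_lt_of_le one_pos (le_max_right _ _)
  calc A * φ (c * t) ^ q ≤ A * (max C 1 * φ t) ^ q := by gcongr
    _ = A * (max C 1) ^ q * φ t ^ q := by rw [Real.mul_rpow hC0.le hp.le]; ring
    _ ≤ φ t ^ (1 - q) * φ t ^ q := by gcongr
    _ = φ t := by rw [← Real.rpow_add hp]; simp

lemma exists_eta (φ : ℝ → ℝ) (hmono : StrictMono φ)
    (h0 : φ 0 = 0) (p q : ℝ) (hqp : q < p) (D c B : ℝ) (hD : 0 < D) (hc : 0 < c) (hB : 0 < B)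
    (hH : ∃ ε > (0:ℝ), ∀ᶠ t in nhdsWithin 0 (Set.Ioi 0), ε ≤ t ^ p / φ t) :
    ∃ η > 0, η ≤ B ∧ φ (D * η) ≤ c * η ^ q := by
  obtain ⟨ε, hε, hH⟩ := hH
  have hDt : Tendsto (fun η : ℝ => D * η) (nhdsWithin 0 (Ioi 0)) (nhdsWithin 0 (Ioi 0)) := by
    apply tendsto_nhdsWithin_of_tendsto_nhds_of_eventually_within
    · have : Continuous fun η : ℝ => D * η := by fun_prop
      have h := this.tendsto 0
      rw [mul_zero] at h
      exact h.mono_left nhdsWithin_le_nhds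
    · filter_upwards [self_mem_nhdsWithin] with η hη
      exact mul_pos hD hη
  have hz : Tendsto (fun η : ℝ => η ^ (p - q)) (nhdsWithin 0 (Ioi 0)) (nhds 0) := by
    have h := (Real.continuousAt_rpow_const 0 (p - q) (Or.inr (by linarith))).tendsto
    rw [Real.zero_rpow (by linarith)] at h
    exact h.mono_left nhdsWithin_le_nhds
  have hk : 0 < c * ε / D ^ p := by positivity
  obtain ⟨η, h1, h2, h3, h4⟩ := ((hDt.eventually hH).and ((hz.eventually_le_const hk).and
    ((eventually_mem_nhdsWithin : ∀ᶠ η in nhdsWithin (0:ℝ) (Ioi 0), η ∈ Ioi 0).and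
      (nhdsWithin_le_nhds (eventually_le_nhds hB))))).exists
  replace h3 : 0 < η := h3
  refine ⟨η, h3, h4, ?_⟩
  have hp : 0 < φ (D * η) := by rw [← h0]; exact hmono (by positivity)
  rw [le_div_iff₀ hp, Real.mul_rpow hD.le h3.le] at h1
  rw [le_div_iff₀ (by positivity)] at h2
  have h5 : η ^ p = η ^ (p - q) * η ^ q := by rw [← Real.rpow_add h3]; simp
  rw [h5] at h1
  have h6 : η ^ (p - q) * D ^ p * η ^ q ≤ c * ε * η ^ q := by gcongr
  have : ε * φ (D * η) ≤ ε * (c * η ^ q) := by linarith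
  exact le_of_mul_le_mul_left this hε

lemma exists_measure (a b : ℝ) (hab : a < b) (m : ℝ → ℝ) (hm : IntegrableOn m (Set.Ioo a b))
    (hm0 : ∀ᵐ x ∂(volume.restrict (Set.Ioo a b)), 0 ≤ m x)
    (hmne : ¬ (∀ᵐ x ∂(volume.restrict (Set.Ioo a b)), m x = 0)) (lam : ℝ) (hlam : 0 < lam) :
    ∃ μ : Measure ℝ, IsFiniteMeasure μ ∧ NullSingletonClass μ ∧
      (∀ x ∈ Icc a b, ∀ g : ℝ → ℝ, ∫ t in a..x, g t ∂μ = ∫ t in a..x, lam * m t * g t) ∧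
      ∃ α β, a < α ∧ α ≤ β ∧ β < b ∧ 0 < μ.real (Ioc α β) := by
  have hres : volume.restrict (Ioo a b) = volume.restrict (Ioc a b) :=
    Measure.restrict_congr_set Ioo_ae_eq_Ioc
  rw [IntegrableOn, hres] at hm
  rw [hres] at hm0 hmne
  set ν := volume.restrict (Ioc a b) with hν
  set d : ℝ → ENNReal := fun x => ENNReal.ofReal (lam * m x) with hd
  have hdm : AEMeasurable d ν := (hm.aestronglyMeasurable.aemeasurable.const_mul lam).ennreal_ofReal
  have hfin : IsFiniteMeasure (ν.withDensity d) :=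
    isFiniteMeasure_withDensity_ofReal (hm.const_mul lam).2
  have hac : ν.withDensity d ≪ volume :=
    (withDensity_absolutelyContinuous _ _).trans Measure.absolutelyContinuous_restrict
  refine ⟨ν.withDensity d, hfin, ⟨fun x => hac (by simp)⟩, ?_, ?_⟩
  · intro x hx g
    rw [intervalIntegral.integral_of_le hx.1, intervalIntegral.integral_of_le hx.1]
    have hsub : ν.restrict (Ioc a x) = volume.restrict (Ioc a x) := by
      rw [hν, Measure.restrict_restrict measurableSet_Ioc, inter_eq_left.2 (Ioc_subset_Ioc_right hx.2)]
    rw [setIntegral_withDensity_eq_setIntegral_toReal_smul₀ hdm.restrict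
      (Eventually.of_forall fun _ => ENNReal.ofReal_lt_top) g measurableSet_Ioc, ← hsub]
    apply integral_congr_ae
    filter_upwards [ae_restrict_of_ae hm0] with t ht
    simp only [hd, smul_eq_mul]
    rw [ENNReal.toReal_ofReal (by positivity)]
  · by_contra! hcon
    have hz : ∀ n : ℕ, ν.withDensity d (Ioc (a + (b - a) / (n + 3)) (b - (b - a) / (n + 3))) = 0 := by
      intro n
      have hba := sub_pos.2 hab
      have h1 : 0 < (b - a) / (n + 3) := by positivity
      have h2 : (b - a) / (n + 3) ≤ (b - a) / 2 := by gcongr; linarith [n.cast_nonneg (α := ℝ)]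
      have := hcon (a + (b - a) / (n + 3)) (b - (b - a) / (n + 3)) (by linarith) (by linarith)
        (by linarith)
      exact (measureReal_eq_zero_iff).1 (le_antisymm this measureReal_nonneg)
    have hU : ν.withDensity d (Ioo a b) = 0 := by
      refine measure_mono_null ?_ (measure_iUnion_null hz)
      intro x hx
      have hlim : Tendsto (fun n : ℕ => (b - a) / ((n : ℝ) + 3)) atTop (nhds 0) :=
        tendsto_const_nhds.div_atTop
          (tendsto_atTop_add_const_right _ _ tendsto_natCast_atTop_atTop)
      have hpos : 0 < min (x - a) (b - x) := lt_min (by linarith [hx.1]) (by linarith [hx.2])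
      obtain ⟨n, hn⟩ := (hlim.eventually_lt_const hpos).exists
      rw [lt_min_iff] at hn
      exact mem_iUnion.2 ⟨n, by constructor <;> linarith [hn.1, hn.2]⟩
    apply hmne
    have h3 : ν.withDensity d univ = 0 := by
      have : ν.withDensity d (Ioo a b)ᶜ = 0 := by
        apply withDensity_absolutelyContinuous
        rw [← hres, Measure.restrict_apply measurableSet_Ioo.compl]
        simp
      rw [← union_compl_self (Ioo a b)]
      exact measure_union_null hU this
    rw [withDensity_apply _ MeasurableSet.univ, Measure.restrict_univ,
      lintegral_eq_zero_iff' hdm] at h3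
    filter_upwards [h3, hm0] with x hx hx0
    simp only [hd, Pi.zero_apply, ENNReal.ofReal_eq_zero] at hx
    nlinarith

/-- Theorem nuevo (ii). Under H1' and F1' with `q₁ ∈ (0,p)`,
`q₂ ∈ (0,1)`, for every `λ > 0` the problem `-(φ(u'))' = λ m f(u)`, `u = 0`
on `∂Ω`, has a solution `u ∈ C¹([a,b])` with `u > 0` in `(a,b)` and
`u'(b) < 0 < u'(a)`. Here `c_Ω = (b-a)/2`; `liminf_{t→0⁺} t^p/φ(t) > 0` and
`limsup_{t→∞} φ(c_Ω t)/φ(t) < ∞` are rendered via their eventual-bound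
characterizations. -/
theorem existence_sublinear_ii
    (a b : ℝ) (hab : a < b)
    (φ : ℝ → ℝ) (hodd : ∀ x, φ (-x) = -φ x) (hmono : StrictMono φ)
    (hcont : Continuous φ) (hsurj : Function.Surjective φ)
    (f : ℝ → ℝ) (hfc : ContinuousOn f (Set.Ici 0)) (hf0 : ∀ t ≥ (0:ℝ), 0 ≤ f t)
    (m : ℝ → ℝ) (hm : IntegrableOn m (Set.Ioo a b))
    (hm0 : ∀ᵐ x ∂(volume.restrict (Set.Ioo a b)), 0 ≤ m x)
    (hmne : ¬ (∀ᵐ x ∂(volume.restrict (Set.Ioo a b)), m x = 0))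
    -- hypothesis H1'
    (p : ℝ) (hp : 0 < p)
    (hH1'a : ∃ ε > (0:ℝ), ∀ᶠ t in nhdsWithin 0 (Set.Ioi 0), ε ≤ t ^ p / φ t)
    (hH1'b : ∃ C : ℝ, ∀ᶠ t in atTop, φ ((b - a) / 2 * t) / φ t ≤ C)
    -- hypothesis F1'
    (tbar k₁ k₂ q₁ q₂ : ℝ) (htbar : 0 < tbar) (hk₁ : 0 < k₁) (hk₂ : 0 < k₂)
    (hq₁ : 0 < q₁) (hq₁p : q₁ < p) (hq₂ : 0 < q₂) (hq₂1 : q₂ < 1)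
    (hF1'a : ∀ t ∈ Set.Icc (0:ℝ) tbar, k₁ * t ^ q₁ ≤ f t)
    (hF1'b : ∀ t ≥ (0:ℝ), f t ≤ k₂ * φ t ^ q₂)
    (lam : ℝ) (hlam : 0 < lam) :
    ∃ u u' : ℝ → ℝ,
      IsSol a b φ (fun x => lam * m x * f (u x)) u u' ∧
      (∀ x ∈ Set.Ioo a b, 0 < u x) ∧ u' b < 0 ∧ 0 < u' a := by
  have hφ0 : φ 0 = 0 := by have := hodd 0; rw [neg_zero] at this; linarith
  have hba : 0 < b - a := sub_pos.2 hab
  -- the inverse of `φ`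
  let e : ℝ ≃o ℝ := StrictMono.orderIsoOfSurjective φ hmono hsurj
  obtain ⟨ψ, hψφ, hφψ, hψc, hψm⟩ : ∃ ψ : ℝ → ℝ, (∀ x, ψ (φ x) = x) ∧ (∀ x, φ (ψ x) = x) ∧
      Continuous ψ ∧ StrictMono ψ :=
    ⟨e.symm, fun x => e.symm_apply_apply x, fun x => e.apply_symm_apply x, e.symm.continuous,
      e.symm.strictMono⟩
  have hψ0 : ψ 0 = 0 := by have := hψφ 0; rwa [hφ0] at this
  have hψodd : ∀ x, ψ (-x) = - ψ x := fun x => by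
    apply hmono.injective
    rw [hφψ, hodd, hφψ]
  obtain ⟨μ, hμf, hμs, hμi, α, β, haα, hαβ, hβb, hμ0⟩ :=
    exists_measure a b hab m hm hm0 hmne lam hlam
  obtain ⟨T, hT, hTφ⟩ := exists_R φ hmono hsurj hφ0 ((b - a) / 2) (by positivity)
    (k₂ * μ.real (Ioc a b)) q₂ (by positivity) hq₂ hq₂1 hH1'b
  set R := (b - a) / 2 * T with hR
  have hR0 : 0 < R := by positivity
  set δ := min (α - a) (b - β) with hδ
  have hδ0 : 0 < δ := lt_min (by linarith) (by linarith)
  set μ₀ := μ.real (Ioc α β) with hμ₀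
  obtain ⟨η, hη, hηB, hηφ⟩ := exists_eta φ hmono hφ0 p q₁ hq₁p ((b - a) / δ)
    (μ₀ * k₁ * δ ^ q₁ / 2) (min tbar R / (b - a)) (by positivity) (by positivity)
    (div_pos (lt_min htbar hR0) hba) hH1'a
  rw [le_div_iff₀ hba, le_min_iff] at hηB
  obtain ⟨hηt, hηR⟩ := hηB
  have hηψ : (b - a) / δ * η ≤ ψ (μ₀ * k₁ * δ ^ q₁ / 2 * η ^ q₁) := by
    rw [← hψφ ((b - a) / δ * η)]
    exact hψm.monotone hηφ
  have hηψ2 : η * (b - a) ≤ δ * ψ (μ₀ * k₁ * δ ^ q₁ / 2 * η ^ q₁) := by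
    have := mul_le_mul_of_nonneg_left hηψ hδ0.le
    refine le_of_eq_of_le ?_ this
    field_simp
  -- the truncated nonlinearity
  set tent : ℝ → ℝ := fun x => max 0 (min (x - a) (b - x)) with htent
  have htent0 : ∀ x, 0 ≤ tent x := fun x => le_max_left _ _
  set cl : ℝ → ℝ → ℝ := fun t z => min (max z (η * tent t)) R with hcl
  have hcl0 : ∀ t z, 0 ≤ cl t z := fun t z =>
    le_min (le_max_of_le_right (mul_nonneg hη.le (htent0 t))) hR0.le
  have hclR : ∀ t z, cl t z ≤ R := fun t z => min_le_right _ _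
  set F : ℝ → ℝ → ℝ := fun t z => f (cl t z) with hF
  have hFc : Continuous (Function.uncurry F) := by
    have h1 : Continuous fun q : ℝ × ℝ => cl q.1 q.2 := by
      simp only [hcl, htent]; fun_prop
    exact hfc.comp_continuous h1 fun q => hcl0 _ _
  have hF0 : ∀ t z, 0 ≤ F t z := fun t z => hf0 _ (hcl0 _ _)
  have hφnn : ∀ x, 0 ≤ x → 0 ≤ φ x := fun x hx => by
    rw [← hφ0]; exact hmono.monotone hx
  have hFK : ∀ t z, F t z ≤ k₂ * φ R ^ q₂ := fun t z => by
    refine (hF1'b _ (hcl0 t z)).trans ?_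
    have := hφnn _ (hcl0 t z)
    have h2 := hmono.monotone (hclR t z)
    gcongr
  obtain ⟨s, hs, w, hwc, hw, hwb⟩ := exists_sol a b hab μ F hFc _ hF0 hFK ψ hψc hψm.monotone hψodd
  set S := k₂ * φ R ^ q₂ * μ.real (Ioc a b) with hS
  have hST : ψ S ≤ T := by
    rw [← hψφ T]
    apply hψm.monotone
    refine le_of_eq_of_le ?_ hTφ
    rw [hS]; ring
  set v : ℝ → ℝ := fun y => s - ∫ t in a..y, F t (w t) ∂μ with hv
  have hgc : Continuous fun t => F t (w t) := hFc.comp (continuous_id.prodMk hwc)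
  have hvc : Continuous v := by
    apply continuous_const.sub
    apply intervalIntegral.continuous_parametric_intervalIntegral_of_continuous
      (f := fun (q : ℝ) t => F t (w t))
    · exact hgc.comp continuous_snd
    · exact continuous_id
  have hψvc : Continuous fun y => ψ (v y) := hψc.comp hvc
  have hii : ∀ x y, IntervalIntegrable (fun y => ψ (v y)) volume x y :=
    fun x y => hψvc.intervalIntegrable _ _
  have hva : v a = s := by simp [hv]
  have hvsub : ∀ x y, v x - v y = ∫ t in x..y, F t (w t) ∂μ := by
    intro x y
    have := intervalIntegral.integral_interval_sub_left (μ := μ)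
      (hgc.intervalIntegrable a y) (hgc.intervalIntegrable a x)
    rw [← this]; simp only [hv]; ring
  have hvanti : ∀ x y, x ≤ y → v y ≤ v x := by
    intro x y hxy
    have h1 := hvsub x y
    have h2 : 0 ≤ ∫ t in x..y, F t (w t) ∂μ :=
      intervalIntegral.integral_nonneg hxy fun t _ => hF0 _ _
    linarith
  have hvS : ∀ y ∈ Icc a b, -S ≤ v y ∧ v y ≤ S := by
    intro y hy
    have := aux_int_bounds μ hgc (fun t => hF0 _ _) (fun t => hFK _ _) hy
    constructor <;> simp only [hv] <;> linarith [hs.1, hs.2]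
  set u : ℝ → ℝ := fun x => ∫ y in a..x, ψ (v y) with hu
  have huw : ∀ x ∈ Icc a b, w x = u x := hw
  have hua : u a = 0 := by simp [hu]
  have hub : u b = 0 := by rw [← huw b ⟨hab.le, le_rfl⟩, hwb]
  have husub : ∀ x y, u y - u x = ∫ t in x..y, ψ (v t) := fun x y =>
    intervalIntegral.integral_interval_sub_left (hii _ _) (hii _ _)
  have hder : ∀ x, HasDerivAt u (ψ (v x)) x := fun x =>
    intervalIntegral.integral_hasDerivAt_right (hii _ _)
      hψvc.stronglyMeasurable.stronglyMeasurableAtFilter hψvc.continuousAt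
  have hlow : ∀ x y k, x ≤ y → (∀ t ∈ Icc x y, k ≤ ψ (v t)) → (y - x) * k ≤ u y - u x := by
    intro x y k hxy h
    rw [husub]
    have := intervalIntegral.integral_mono_on hxy
      (continuous_const.intervalIntegrable (μ := volume) (u := fun _ => k) _ _) (hii x y) h
    simpa using this
  have hupp : ∀ x y k, x ≤ y → (∀ t ∈ Icc x y, ψ (v t) ≤ k) → u y - u x ≤ (y - x) * k := by
    intro x y k hxy h
    rw [husub]
    have := intervalIntegral.integral_mono_on hxy (hii x y)
      (continuous_const.intervalIntegrable (μ := volume) (u := fun _ => k) _ _) h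
    simpa using this
  -- upper bound
  have huR : ∀ x ∈ Icc a b, u x ≤ R := by
    intro x hx
    have h1 := hupp a x T hx.1 fun t ht =>
      (hψm.monotone (hvS t ⟨ht.1, ht.2.trans hx.2⟩).2).trans hST
    have h2 := hlow x b (-T) hx.2 fun t ht => by
      have := hψm.monotone (hvS t ⟨hx.1.trans ht.1, ht.2⟩).1
      rw [hψodd] at this
      linarith
    rw [hua] at h1
    rw [hub] at h2
    rw [hR]
    linarith
  -- the lower bound at one point
  have hpt : ∃ x₀ ∈ Ioo a b, η * (b - a) ≤ u x₀ := by
    by_contra! hcon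
    have hαm : α ∈ Ioo a b := ⟨haα, by linarith⟩
    have hβm : β ∈ Ioo a b := ⟨by linarith, hβb⟩
    set κ := μ₀ * k₁ * δ ^ q₁ / 2 * η ^ q₁ with hκ
    have hFl : ∀ t ∈ Icc α β, k₁ * (η * δ) ^ q₁ ≤ F t (w t) := by
      intro t ht
      have htm : t ∈ Ioo a b := ⟨by linarith [ht.1], by linarith [ht.2]⟩
      have htd : δ ≤ tent t := by
        apply le_max_of_le_right
        exact min_le_min (by linarith [ht.1]) (by linarith [ht.2])
      have htb : tent t ≤ b - a :=
        max_le hba.le ((min_le_left _ _).trans (by linarith [htm.2]))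
      have h1 : η * δ ≤ cl t (w t) := by
        apply le_min
        · apply le_max_of_le_right; gcongr
        · refine le_trans ?_ hηR
          gcongr
          exact htd.trans htb
      have h2 : cl t (w t) ≤ tbar := by
        refine (min_le_left _ _).trans ((max_le ?_ ?_).trans hηt)
        · rw [huw t ⟨htm.1.le, htm.2.le⟩]; exact (hcon t htm).le
        · gcongr
      refine le_trans ?_ (hF1'a _ ⟨hcl0 _ _, h2⟩)
      gcongr
    have hκ2 : 2 * κ ≤ v α - v β := by
      rw [hvsub]
      have := intervalIntegral.integral_mono_on (μ := μ) hαβ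
        (continuous_const.intervalIntegrable (u := fun _ => k₁ * (η * δ) ^ q₁) _ _)
        (hgc.intervalIntegrable _ _) hFl
      refine le_trans (le_of_eq ?_) this
      rw [intervalIntegral.integral_of_le hαβ, setIntegral_const, smul_eq_mul,
        Real.mul_rpow hη.le hδ0.le, hκ, ← hμ₀]
      ring
    have hψκ : 0 ≤ ψ κ := by
      rw [← hψ0]; apply hψm.monotone; positivity
    rcases le_or_gt κ (v α) with h | h
    · have h1 := hlow a α (ψ κ) haα.le fun t ht => hψm.monotone (h.trans (hvanti _ _ ht.2))
      have h2 : δ * ψ κ ≤ (α - a) * ψ κ := by gcongr; exact min_le_left _ _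
      have := hcon α hαm
      rw [hua] at h1
      linarith
    · have h1 := hupp β b (-ψ κ) hβb.le fun t ht => by
        rw [← hψodd]
        apply hψm.monotone
        have := hvanti _ _ ht.1
        linarith
      have h2 : δ * ψ κ ≤ (b - β) * ψ κ := by gcongr; exact min_le_right _ _
      have := hcon β hβm
      rw [hub] at h1
      linarith
  obtain ⟨x₀, hx₀, hux₀⟩ := hpt
  have hconc : ConcaveOn ℝ (Icc a b) u := by
    apply AntitoneOn.concaveOn_of_deriv (convex_Icc a b)
    · exact fun x _ => (hder x).continuousAt.continuousWithinAt
    · exact fun x _ => (hder x).differentiableAt.differentiableWithinAt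
    · intro x _ y _ hxy
      rw [(hder x).deriv, (hder y).deriv]
      exact hψm.monotone (hvanti _ _ hxy)
  have hlb : ∀ x ∈ Icc a b, η * tent x ≤ u x := by
    intro x hx
    have htx : tent x = min (x - a) (b - x) :=
      max_eq_right (le_min (by linarith [hx.1]) (by linarith [hx.2]))
    have hmem0 : x₀ ∈ Icc a b := ⟨hx₀.1.le, hx₀.2.le⟩
    rcases le_total x x₀ with h | h
    · have hd : 0 < x₀ - a := by linarith [hx₀.1]
      have h1 := hconc.2 (⟨le_rfl, hab.le⟩ : a ∈ Icc a b) hmem0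
        (div_nonneg (by linarith) hd.le : 0 ≤ (x₀ - x) / (x₀ - a))
        (div_nonneg (by linarith [hx.1]) hd.le : 0 ≤ (x - a) / (x₀ - a))
        (by field_simp; ring)
      simp only [smul_eq_mul] at h1
      have h2 : (x₀ - x) / (x₀ - a) * a + (x - a) / (x₀ - a) * x₀ = x := by field_simp; ring
      rw [h2, hua, mul_zero, zero_add] at h1
      refine le_trans ?_ h1
      rw [div_mul_eq_mul_div, le_div_iff₀ hd]
      have h3 : tent x ≤ x - a := by rw [htx]; exact min_le_left _ _
      calc η * tent x * (x₀ - a) ≤ η * (x - a) * (b - a) := by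
            have := hx.1
            have := hx₀.2.le
            gcongr
        _ = (x - a) * (η * (b - a)) := by ring
        _ ≤ _ := by have := sub_nonneg.2 hx.1; gcongr
    · have hd : 0 < b - x₀ := by linarith [hx₀.2]
      have h1 := hconc.2 hmem0 (⟨hab.le, le_rfl⟩ : b ∈ Icc a b)
        (div_nonneg (by linarith [hx.2]) hd.le : 0 ≤ (b - x) / (b - x₀))
        (div_nonneg (by linarith) hd.le : 0 ≤ (x - x₀) / (b - x₀))
        (by field_simp; ring)
      simp only [smul_eq_mul] at h1
      have h2 : (b - x) / (b - x₀) * x₀ + (x - x₀) / (b - x₀) * b = x := by field_simp; ring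
      rw [h2, hub, mul_zero, add_zero] at h1
      refine le_trans ?_ h1
      rw [div_mul_eq_mul_div, le_div_iff₀ hd]
      have h3 : tent x ≤ b - x := by rw [htx]; exact min_le_right _ _
      have h4 := sub_nonneg.2 hx.2
      calc η * tent x * (b - x₀) ≤ η * (b - x) * (b - a) := by
            have := hx₀.1.le
            gcongr
        _ = (b - x) * (η * (b - a)) := by ring
        _ ≤ _ := by gcongr
  have hFf : ∀ t ∈ Icc a b, F t (w t) = f (u t) := by
    intro t ht
    simp only [hF, hcl]
    rw [huw t ht, max_eq_left (hlb t ht), min_eq_left (huR t ht)]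
  have hpos : ∀ x ∈ Ioo a b, 0 < u x := by
    intro x hx
    refine lt_of_lt_of_le (mul_pos hη ?_) (hlb x ⟨hx.1.le, hx.2.le⟩)
    exact lt_max_of_lt_right (lt_min (by linarith [hx.1]) (by linarith [hx.2]))
  refine ⟨u, fun x => ψ (v x), ⟨hua, hub, hψvc.continuousOn,
    fun x _ => (hder x).hasDerivWithinAt, ?_⟩, hpos, ?_, ?_⟩
  · intro x hx
    simp only [hφψ]
    rw [hva, ← hμi x hx (fun t => f (u t))]
    simp only [hv]
    congr 1
    apply intervalIntegral.integral_congr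
    intro t ht
    rw [uIcc_of_le hx.1] at ht
    exact hFf t ⟨ht.1, ht.2.trans hx.2⟩
  · by_contra! h
    have h1 := hlow x₀ b 0 hx₀.2.le fun t ht => h.trans (hψm.monotone (hvanti _ _ ht.2))
    have := hpos x₀ hx₀
    rw [hub] at h1
    linarith
  · by_contra! h
    have h1 := hupp a x₀ 0 hx₀.1.le fun t ht => (hψm.monotone (hvanti _ _ ht.1)).trans h
    have := hpos x₀ hx₀
    rw [hua] at h1
    linarith
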